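/- Let Π and Π' be orthogonal projectors (Hermitian idempotent d×d complex matrices) and let σ be a d×d density matrix commuting with Π' (i.e. Π'σ = σΠ'). Then the real part of 1 − Tr((2Π − 𝟙)·Π'·σ) is at most 3 − 2·Tr(Πσ) − Tr(Π'σ); equivalently, Re Tr((2Π − 𝟙)Π'σ) ≥ 2·Tr(Πσ) + Tr(Π'σ) − 2. -/

import Mathlib

open Finset Real
open scoped ComplexOrder

/-- The key trace inequality from the proof of the packing lemma: for projectors `P`, `P'`
and a density matrix `σ` commuting with `P'`,
`Re Tr((2P − 𝟙) P' σ) ≥ 2 Tr(Pσ) + Tr(P'σ) − 2`. -/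
theorem packing_trace_inequality {d : ℕ}
    (P P' σ : Matrix (Fin d) (Fin d) ℂ)
    (hPherm : P.IsHermitian) (hPidem : P * P = P)
    (hP'herm : P'.IsHermitian) (hP'idem : P' * P' = P')
    (hσ : σ.PosSemidef) (hσtr : Matrix.trace σ = 1)
    (hcomm : P' * σ = σ * P') :
    2 * (Matrix.trace (P * σ)).re + (Matrix.trace (P' * σ)).re - 2 ≤
      (Matrix.trace (((2 : ℂ) • P - 1) * P' * σ)).re := by
  have h := (hσ.mul_mul_conjTranspose_same ((1 - P) * (1 - P'))).trace_nonneg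
  have e : ((1 - P) * (1 - P') * σ * ((1 - P) * (1 - P')).conjTranspose).trace
      = 1 - (P * σ).trace - (P' * σ).trace + (P * P' * σ).trace := by
    rw [Matrix.conjTranspose_mul, Matrix.conjTranspose_sub, Matrix.conjTranspose_sub,
      Matrix.conjTranspose_one, hPherm.eq, hP'herm.eq, ← mul_assoc, Matrix.trace_mul_comm]
    have hR : (1 - P) * (1 - P) = 1 - P := by
      simp [mul_sub, sub_mul, hPidem]
    have hQ : (1 - P') * σ * (1 - P') = (1 - P') * σ := by
      have h1 : P' * σ * P' = P' * σ := by
        rw [mul_assoc, ← hcomm, ← mul_assoc, hP'idem]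
      simp [mul_sub, sub_mul, h1, ← hcomm]
    have : (1 - P) * ((1 - P) * (1 - P') * σ * (1 - P'))
        = ((1 - P) * (1 - P)) * ((1 - P') * σ * (1 - P')) := by
      simp only [mul_assoc]
    rw [this, hR, hQ]
    simp only [sub_mul, mul_sub, one_mul, Matrix.trace_sub, hσtr, mul_assoc]
    ring
  rw [e] at h
  have h' := (Complex.le_def.1 h).1
  simp only [sub_mul, one_mul, Matrix.smul_mul, Matrix.trace_sub, Matrix.trace_smul]
  simp at h' ⊢
  linarith
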